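/- (Minimax theorem of Jeanjean–Lu, as used in the paper) Let E be a real Banach space continuously embedded in a real Hilbert space H (identified with its dual), m > 0, and M = {u ∈ E : (u,u)_H = m} endowed with the topology of E. Let I : E → ℝ be an even C¹ functional such that I restricted to M is bounded from below and satisfies the Palais–Smale condition at every level c < 0, and suppose Γ_k := {A ⊆ M : A closed, symmetric (A = −A), genus 𝒢(A) ≥ k} is nonempty for each k = 1, …, n. Define c_k := inf_{A ∈ Γ_k} sup_{u ∈ A} I(u), k = 1, …, n. Then −∞ < c₁ ≤ c₂ ≤ … ≤ c_n, and: (i) if c_k < 0 then c_k is a critical value of I restricted to M; (ii) if c_k = c_{k+1} = … = c_{k+l-1} =: c < 0 for some k, l ≥ 1, then the set K^c of critical points of I|_M at level c satisfies 𝒢(K^c) ≥ l. In particular I|_M has at least n critical points. -/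

import Mathlib

open Filter Topology
open scoped RealInnerProductSpace ENat

noncomputable section

variable {E : Type*} [NormedAddCommGroup E] [NormedSpace ℝ E] [CompleteSpace E]
variable {H : Type*} [NormedAddCommGroup H] [InnerProductSpace ℝ H] [CompleteSpace H]

/-- The Krasnoselskii genus of a (symmetric) subset `A` of `E`:
the least `k` for which there is an odd continuous map `A → ℝ^k \ {0}`,
`∞` if there is none, and `0` for the empty set. -/
def genus (A : Set E) : ℕ∞ :=
  sInf {k : ℕ∞ | ∃ n : ℕ, k = (n : ℕ∞) ∧
    ∃ φ : E → EuclideanSpace ℝ (Fin n),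
      ContinuousOn φ A ∧ (∀ x ∈ A, φ (-x) = -φ x) ∧ ∀ x ∈ A, φ x ≠ 0}

/-- The norm of the derivative of `I` restricted to the constraint manifold
`M = {u | ⟪ιu, ιu⟫ = m}`, at the point `u`:
`‖I'|_M(u)‖ = sup {|⟨I'(u), v⟩| : v ∈ T_u M, ‖v‖ ≤ 1}`. -/
def cNorm (I : E → ℝ) (ι : E →L[ℝ] H) (u : E) : ℝ :=
  sSup {r : ℝ | ∃ v : E, ⟪ι u, ι v⟫ = 0 ∧ ‖v‖ ≤ 1 ∧ r = |fderiv ℝ I u v|}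

/-- `I` restricted to `M` satisfies the Palais–Smale condition at level `c`. -/
def PSCond (I : E → ℝ) (ι : E →L[ℝ] H) (m c : ℝ) : Prop :=
  ∀ un : ℕ → E, (∀ n, ⟪ι (un n), ι (un n)⟫ = m) →
    Tendsto (fun n => I (un n)) atTop (𝓝 c) →
    Tendsto (fun n => cNorm I ι (un n)) atTop (𝓝 0) →
    ∃ (u : E) (σ : ℕ → ℕ), StrictMono σ ∧
      Tendsto (fun k => un (σ k)) atTop (𝓝 u)


/-! ### Continuous equivariant selections -/

/-- An odd continuous selection of a convex-valued, odd set-valued map which admits locally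
constant selections. -/
theorem exists_odd_selection {X F : Type*} [NormedAddCommGroup X]
    [NormedAddCommGroup F] [NormedSpace ℝ F] {T : X → Set F}
    (hconv : ∀ x, Convex ℝ (T x)) (hodd : ∀ x, ∀ v ∈ T x, -v ∈ T (-x))
    (hloc : ∀ x, ∃ v, ∀ᶠ y in 𝓝 x, v ∈ T y) :
    ∃ g : X → F, Continuous g ∧ (∀ x, g (-x) = -g x) ∧ ∀ x, g x ∈ T x := by
  obtain ⟨g, hg⟩ := exists_continuous_forall_mem_convex_of_local_const hconv hloc
  refine ⟨fun x => (1 / 2 : ℝ) • g x + (1 / 2 : ℝ) • (-g (-x)), by fun_prop, fun x => ?_,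
    fun x => ?_⟩
  · simp only [neg_neg]
    module
  · refine hconv x (hg x) ?_ (by norm_num) (by norm_num) (by norm_num)
    simpa using hodd (-x) _ (hg (-x))

/-- An even continuous selection of a convex-valued, even set-valued map which admits locally
constant selections. -/
theorem exists_even_selection {X F : Type*} [NormedAddCommGroup X]
    [NormedAddCommGroup F] [NormedSpace ℝ F] {T : X → Set F}
    (hconv : ∀ x, Convex ℝ (T x)) (heven : ∀ x, ∀ v ∈ T x, v ∈ T (-x))
    (hloc : ∀ x, ∃ v, ∀ᶠ y in 𝓝 x, v ∈ T y) :
    ∃ g : X → F, Continuous g ∧ (∀ x, g (-x) = g x) ∧ ∀ x, g x ∈ T x := by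
  obtain ⟨g, hg⟩ := exists_continuous_forall_mem_convex_of_local_const hconv hloc
  refine ⟨fun x => (1 / 2 : ℝ) • g x + (1 / 2 : ℝ) • g (-x), by fun_prop, fun x => ?_,
    fun x => ?_⟩
  · simp only [neg_neg]
    module
  · refine hconv x (hg x) ?_ (by norm_num) (by norm_num) (by norm_num)
    simpa using heven (-x) _ (hg (-x))

/-- An odd continuous map on a closed symmetric set extends to an odd continuous map on the
whole space. -/
theorem exists_odd_extension {X F : Type*} [NormedAddCommGroup X]
    [NormedAddCommGroup F] [NormedSpace ℝ F] [FiniteDimensional ℝ F] {A : Set X}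
    (hA : IsClosed A) (hsymm : ∀ x ∈ A, -x ∈ A) {φ : X → F} (hφ : ContinuousOn φ A)
    (hodd : ∀ x ∈ A, φ (-x) = -φ x) :
    ∃ ψ : X → F, Continuous ψ ∧ (∀ x, ψ (-x) = -ψ x) ∧ ∀ x ∈ A, ψ x = φ x := by
  obtain ⟨g, hg⟩ := ContinuousMap.exists_restrict_eq hA ⟨A.domRestrict φ, hφ.domRestrict⟩
  have hgA : ∀ x ∈ A, g x = φ x := fun x hx => DFunLike.congr_fun hg ⟨x, hx⟩
  refine ⟨fun x => (1 / 2 : ℝ) • (g x - g (-x)), by fun_prop, fun x => ?_, fun x hx => ?_⟩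
  · simp only [neg_neg]
    module
  · simp only [hgA x hx, hgA _ (hsymm x hx), hodd x hx]
    module

/-! ### Elementary properties of the genus -/

section Genus

variable {X : Type*} [NormedAddCommGroup X]

theorem genus_le_of_odd_map {A : Set X} {k : ℕ} {φ : X → EuclideanSpace ℝ (Fin k)}
    (hφ : ContinuousOn φ A) (hodd : ∀ x ∈ A, φ (-x) = -φ x) (hne : ∀ x ∈ A, φ x ≠ 0) :
    genus A ≤ k :=
  sInf_le ⟨k, rfl, φ, hφ, hodd, hne⟩

/-- It suffices to map into some space of dimension at most `k`. -/
theorem genus_le_finrank {A : Set X} {F : Type*} [NormedAddCommGroup F] [NormedSpace ℝ F]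
    [FiniteDimensional ℝ F] {φ : X → F}
    (hφ : ContinuousOn φ A) (hodd : ∀ x ∈ A, φ (-x) = -φ x) (hne : ∀ x ∈ A, φ x ≠ 0) :
    genus A ≤ Module.finrank ℝ F := by
  let e : F ≃L[ℝ] EuclideanSpace ℝ (Fin (Module.finrank ℝ F)) :=
    ContinuousLinearEquiv.ofFinrankEq (by simp)
  refine genus_le_of_odd_map (φ := fun x => e (φ x)) (e.continuous.comp_continuousOn hφ) ?_ ?_
  · intro x hx
    simp [hodd x hx]
  · intro x hx
    simpa using hne x hx

theorem exists_odd_map_of_genus_le {A : Set X} {k : ℕ} (h : genus A ≤ k) :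
    ∃ j ≤ k, ∃ φ : X → EuclideanSpace ℝ (Fin j),
      ContinuousOn φ A ∧ (∀ x ∈ A, φ (-x) = -φ x) ∧ ∀ x ∈ A, φ x ≠ 0 := by
  have hne : {k : ℕ∞ | ∃ n : ℕ, k = (n : ℕ∞) ∧ ∃ φ : X → EuclideanSpace ℝ (Fin n),
      ContinuousOn φ A ∧ (∀ x ∈ A, φ (-x) = -φ x) ∧ ∀ x ∈ A, φ x ≠ 0}.Nonempty := by
    by_contra hemp
    rw [Set.not_nonempty_iff_eq_empty] at hemp
    rw [genus, hemp, sInf_empty] at h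
    exact absurd h (by simp)
  obtain ⟨j, hj, hφ⟩ := csInf_mem hne
  refine ⟨j, ?_, hφ⟩
  change genus A = j at hj
  rw [hj] at h
  exact_mod_cast h

theorem genus_empty : genus (∅ : Set X) = 0 := by
  refine le_antisymm ?_ zero_le
  exact_mod_cast genus_le_of_odd_map (k := 0) (φ := fun _ => 0) continuousOn_const (by simp)
    (by simp)

theorem nonempty_of_one_le_genus {A : Set X} (h : 1 ≤ genus A) : A.Nonempty := by
  rw [Set.nonempty_iff_ne_empty]
  rintro rfl
  simp [genus_empty] at h

theorem genus_le_of_mapsTo {A B : Set X} {η : X → X} (hη : ContinuousOn η A)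
    (hodd : ∀ x ∈ A, η (-x) = -η x) (hmaps : Set.MapsTo η A B) : genus A ≤ genus B := by
  induction h : genus B using ENat.recTopCoe with
  | top => exact le_top
  | coe k =>
    obtain ⟨j, hj, φ, hφ, hφodd, hφne⟩ := exists_odd_map_of_genus_le h.le
    refine (genus_le_of_odd_map (φ := φ ∘ η) (hφ.comp hη hmaps) ?_ ?_).trans
      (by exact_mod_cast hj)
    · intro x hx
      simp [hodd x hx, hφodd _ (hmaps hx)]
    · exact fun x hx => hφne _ (hmaps hx)

/-- Subadditivity: one of the pieces is given by a globally defined odd map. -/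
theorem genus_le_add {A B : Set X} (hB : IsClosed B) (hBsymm : ∀ x ∈ B, -x ∈ B) {k j : ℕ}
    (hk : genus B ≤ k) {ψ : X → EuclideanSpace ℝ (Fin j)} (hψ : Continuous ψ)
    (hψodd : ∀ x, ψ (-x) = -ψ x) (hA : ∀ x ∈ A, x ∈ B ∨ ψ x ≠ 0) :
    genus A ≤ (k + j : ℕ) := by
  obtain ⟨i, hi, φ, hφ, hφodd, hφne⟩ := exists_odd_map_of_genus_le hk
  obtain ⟨φ', hφ', hφ'odd, hφ'eq⟩ := exists_odd_extension hB hBsymm hφ hφodd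
  refine (genus_le_finrank (φ := fun x => (φ' x, ψ x)) (by fun_prop) ?_ ?_).trans ?_
  · intro x _
    simp [hφ'odd, hψodd]
  · intro x hx h
    rw [Prod.mk_eq_zero] at h
    rcases hA x hx with hxB | hxψ
    · exact hφne x hxB (by rw [← hφ'eq x hxB, h.1])
    · exact hxψ h.2
  · rw [Module.finrank_prod, finrank_euclideanSpace_fin, finrank_euclideanSpace_fin]
    exact_mod_cast Nat.add_le_add_right hi j

/-- A finite symmetric set that avoids the origin has genus at most one. -/
theorem genus_le_one_of_finite [NormedSpace ℝ X] {A : Set X} (hA : A.Finite) (h0 : (0 : X) ∉ A) :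
    genus A ≤ 1 := by
  classical
  let φ : X → ℝ := fun x => if WellOrderingRel x (-x) then 1 else -1
  have hφ : ∀ x, φ x ≠ 0 := fun x => by
    dsimp only [φ]
    split_ifs <;> norm_num
  have := genus_le_finrank (A := A) (φ := φ) (hA.continuousOn φ) ?_ fun x _ => hφ x
  · simpa using this
  · intro x hx
    have hne : x ≠ -x := by
      intro h
      have h2 : (2 : ℝ) • x = 0 := by
        rw [two_smul]
        exact add_eq_zero_iff_eq_neg.mpr h
      rw [smul_eq_zero_iff_right two_ne_zero] at h2
      exact h0 (h2 ▸ hx)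
    dsimp only [φ]
    rw [neg_neg]
    rcases trichotomous_of WellOrderingRel x (-x) with h | h | h
    · rw [if_neg (asymm_of WellOrderingRel h), if_pos h]
    · exact absurd h hne
    · rw [if_pos h, if_neg (asymm_of WellOrderingRel h), neg_neg]

end Genus

/-! ### Geometry of the constraint -/

section Constraint

variable {X : Type*} [NormedAddCommGroup X] [NormedSpace ℝ X]
variable {Y : Type*} [NormedAddCommGroup Y] [InnerProductSpace ℝ Y]

/-- The constraint `{u | ⟪ι u, ι u⟫ = m}`. -/
def constraintSet (ι : X →L[ℝ] Y) (m : ℝ) : Set X := {u | ⟪ι u, ι u⟫ = m}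

/-- The radial retraction onto the constraint. -/
def radialRetract (ι : X →L[ℝ] Y) (m : ℝ) (x : X) : X := (√m / ‖ι x‖) • x

/-- The projection onto the tangent space of the constraint at `w` along `w`. -/
def tangentProj (ι : X →L[ℝ] Y) (m : ℝ) (w : X) : X →L[ℝ] X :=
  ContinuousLinearMap.id ℝ X - (m⁻¹ • (innerSL ℝ (ι w)).comp ι).smulRight w

theorem tangentProj_apply (ι : X →L[ℝ] Y) (m : ℝ) (w v : X) :
    tangentProj ι m w v = v - (m⁻¹ * ⟪ι w, ι v⟫) • w := by
  simp [tangentProj]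

theorem tangentProj_neg (ι : X →L[ℝ] Y) (m : ℝ) (w v : X) :
    tangentProj ι m (-w) v = tangentProj ι m w v := by
  simp [tangentProj_apply]

theorem continuous_tangentProj (ι : X →L[ℝ] Y) (m : ℝ) (v : X) :
    Continuous fun w => tangentProj ι m w v := by
  simp only [tangentProj_apply]
  fun_prop

theorem tangentProj_eq_self {ι : X →L[ℝ] Y} {w v : X} (m : ℝ) (h : ⟪ι w, ι v⟫ = 0) :
    tangentProj ι m w v = v := by
  simp [tangentProj_apply, h]

theorem inner_tangentProj {ι : X →L[ℝ] Y} {m : ℝ} (hm : 0 < m) {w : X}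
    (hw : w ∈ constraintSet ι m) (v : X) : ⟪ι w, ι (tangentProj ι m w v)⟫ = 0 := by
  have hw' : ⟪ι w, ι w⟫ = m := hw
  rw [tangentProj_apply, map_sub, map_smul, inner_sub_right, inner_smul_right, hw']
  field_simp
  ring

theorem isClosed_constraintSet (ι : X →L[ℝ] Y) (m : ℝ) : IsClosed (constraintSet ι m) :=
  isClosed_eq (by fun_prop) continuous_const

theorem neg_mem_constraintSet {ι : X →L[ℝ] Y} {m : ℝ} {w : X} (hw : w ∈ constraintSet ι m) :
    -w ∈ constraintSet ι m := by
  simpa [constraintSet] using hw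

theorem ne_zero_of_mem_constraintSet {ι : X →L[ℝ] Y} {m : ℝ} (hm : 0 < m) {w : X}
    (hw : w ∈ constraintSet ι m) : w ≠ 0 := by
  rintro rfl
  simp [constraintSet] at hw
  exact hm.ne hw

theorem norm_of_mem_constraintSet {ι : X →L[ℝ] Y} {m : ℝ} {w : X}
    (hw : w ∈ constraintSet ι m) : ‖ι w‖ = √m := by
  rw [norm_eq_sqrt_real_inner, show ⟪ι w, ι w⟫ = m from hw]

theorem radialRetract_neg (ι : X →L[ℝ] Y) (m : ℝ) (x : X) :
    radialRetract ι m (-x) = -radialRetract ι m x := by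
  simp [radialRetract]

theorem radialRetract_eq_self {ι : X →L[ℝ] Y} {m : ℝ} (hm : 0 < m) {w : X}
    (hw : w ∈ constraintSet ι m) : radialRetract ι m w = w := by
  rw [radialRetract, norm_of_mem_constraintSet hw, div_self (Real.sqrt_pos.mpr hm).ne', one_smul]

theorem radialRetract_mem {ι : X →L[ℝ] Y} (hι : Function.Injective ι) {m : ℝ} (hm : 0 < m)
    {x : X} (hx : x ≠ 0) : radialRetract ι m x ∈ constraintSet ι m := by
  have hx' : ‖ι x‖ ≠ 0 := by
    rw [norm_ne_zero_iff]
    exact (map_ne_zero_iff ι hι).mpr hx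
  rw [constraintSet, Set.mem_ofPred_eq, real_inner_self_eq_norm_sq, radialRetract, map_smul,
    norm_smul, Real.norm_of_nonneg (by positivity), div_mul_cancel₀ _ hx', Real.sq_sqrt hm.le]

theorem continuousAt_radialRetract {ι : X →L[ℝ] Y} (hι : Function.Injective ι) (m : ℝ)
    {x : X} (hx : x ≠ 0) : ContinuousAt (radialRetract ι m) x := by
  have hx' : ‖ι x‖ ≠ 0 := by
    rw [norm_ne_zero_iff]
    exact (map_ne_zero_iff ι hι).mpr hx
  unfold radialRetract
  fun_prop (disch := assumption)

theorem hasStrictFDerivAt_radialRetract {ι : X →L[ℝ] Y} {m : ℝ} (hm : 0 < m) {w : X}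
    (hw : w ∈ constraintSet ι m) :
    HasStrictFDerivAt (radialRetract ι m) (tangentProj ι m w) w := by
  have hs : 0 < √m := Real.sqrt_pos.mpr hm
  have hnorm := norm_of_mem_constraintSet hw
  have h1 : HasStrictFDerivAt (fun x => ‖ι x‖ ^ 2) (2 • (innerSL ℝ (ι w)).comp ι) w :=
    ((hasStrictFDerivAt_norm_sq (ι w)).comp w ι.hasStrictFDerivAt).congr_fderiv (by ext; simp)
  have h2 := h1.sqrt (by rw [hnorm]; positivity)
  have h3 := (((hasStrictDerivAt_inv (x := √(‖ι w‖ ^ 2)) (by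
    rw [Real.sqrt_sq (norm_nonneg _), hnorm]; exact hs.ne')).comp_hasStrictFDerivAt w h2).const_mul
      (√m)).smul (hasStrictFDerivAt_id w)
  have hfun : radialRetract ι m = fun x => (√m * (√(‖ι x‖ ^ 2))⁻¹) • id x := by
    ext x
    rw [Real.sqrt_sq (norm_nonneg _), radialRetract, div_eq_mul_inv, id]
  rw [hfun]
  refine h3.congr_fderiv ?_
  ext v
  simp [tangentProj_apply, hnorm, Real.sqrt_sq hs.le]
  rw [mul_inv_cancel₀ hs.ne', one_smul, sub_eq_add_neg, ← neg_smul, Real.sq_sqrt hm.le]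
  congr 2
  field_simp
  exact neg_smul _ _

end Constraint

/-- First order expansion of a strictly differentiable map along a continuous field of
directions, uniformly in the base point. -/
theorem HasStrictFDerivAt.eventually_norm_sub_le {X F : Type*} [NormedAddCommGroup X]
    [NormedSpace ℝ X] [NormedAddCommGroup F] [NormedSpace ℝ F] {G : X → F} {D : X →L[ℝ] F}
    {x : X} (hG : HasStrictFDerivAt G D x) {V : X → X} (hV : ContinuousAt V x) {κ : ℝ}
    (hκ : 0 < κ) :
    ∀ᶠ p : X × ℝ in 𝓝 x ×ˢ 𝓝 0,
      ‖G (p.1 + p.2 • V p.1) - G p.1 - p.2 • D (V x)‖ ≤ κ * ‖p.2‖ := by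
  rw [← nhds_prod_eq]
  have hV1 : ContinuousAt (fun p : X × ℝ => V p.1) (x, 0) :=
    ContinuousAt.comp (f := Prod.fst) (g := V) hV continuousAt_fst
  have htend : Tendsto (fun p : X × ℝ => (p.1 + p.2 • V p.1, p.1)) (𝓝 (x, 0)) (𝓝 (x, x)) := by
    have : ContinuousAt (fun p : X × ℝ => (p.1 + p.2 • V p.1, p.1)) (x, 0) := by fun_prop
    simpa [ContinuousAt] using this
  have h1 : (fun p : X × ℝ => G (p.1 + p.2 • V p.1) - G p.1 - D (p.2 • V p.1))
      =o[𝓝 (x, 0)] fun p => p.2 • V p.1 := by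
    simpa [Function.comp_def] using hG.isLittleO.comp_tendsto htend
  have h2 : (fun p : X × ℝ => p.2 • V p.1) =O[𝓝 (x, 0)] fun p => p.2 := by
    simpa using (Asymptotics.isBigO_refl (fun p : X × ℝ => p.2) (𝓝 (x, 0))).smul
      (hV1.isBigO_one ℝ)
  have h3 : (fun p : X × ℝ => p.2 • (D (V p.1) - D (V x))) =o[𝓝 (x, 0)] fun p => p.2 := by
    have h0 : (fun p : X × ℝ => D (V p.1) - D (V x)) =o[𝓝 (x, 0)] fun _ => (1 : ℝ) := by
      rw [Asymptotics.isLittleO_one_iff]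
      have : ContinuousAt (fun p : X × ℝ => D (V p.1) - D (V x)) (x, 0) := by fun_prop
      simpa [ContinuousAt] using this
    simpa using (Asymptotics.isBigO_refl (fun p : X × ℝ => p.2) (𝓝 (x, 0))).smul_isLittleO h0
  have h4 := ((h1.trans_isBigO h2).add h3).bound hκ
  filter_upwards [h4] with p hp
  rw [map_smul, smul_sub] at hp
  simpa using hp

/-! ### The norm of the constrained derivative -/

section ConstrainedDerivative

variable {X : Type*} [NormedAddCommGroup X] [NormedSpace ℝ X]
variable {Y : Type*} [NormedAddCommGroup Y] [InnerProductSpace ℝ Y]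

theorem abs_fderiv_le_cNorm (I : X → ℝ) (ι : X →L[ℝ] Y) {u v : X} (hv : ⟪ι u, ι v⟫ = 0)
    (hv1 : ‖v‖ ≤ 1) : |fderiv ℝ I u v| ≤ cNorm I ι u := by
  refine le_csSup ⟨‖fderiv ℝ I u‖, ?_⟩ ⟨v, hv, hv1, rfl⟩
  rintro r ⟨w, -, hw, rfl⟩
  exact (fderiv ℝ I u).unit_le_opNorm w hw

theorem cNorm_nonneg (I : X → ℝ) (ι : X →L[ℝ] Y) (u : X) : 0 ≤ cNorm I ι u :=
  (abs_nonneg _).trans (abs_fderiv_le_cNorm I ι (v := 0) (by simp) (by simp))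

theorem abs_fderiv_le_cNorm_mul (I : X → ℝ) (ι : X →L[ℝ] Y) {u v : X} (hv : ⟪ι u, ι v⟫ = 0) :
    |fderiv ℝ I u v| ≤ cNorm I ι u * ‖v‖ := by
  rcases eq_or_ne v 0 with rfl | hne
  · simp
  have hpos : 0 < ‖v‖ := norm_pos_iff.mpr hne
  have h := abs_fderiv_le_cNorm I ι (u := u) (v := ‖v‖⁻¹ • v)
    (by rw [map_smul, inner_smul_right, hv, mul_zero]) (by rw [norm_smul, norm_inv, norm_norm, inv_mul_cancel₀ hpos.ne'])
  rw [map_smul, smul_eq_mul, abs_mul, abs_of_pos (inv_pos.mpr hpos)] at h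
  rwa [inv_mul_le_iff₀ hpos, mul_comm] at h

theorem exists_fderiv_lt_of_lt_cNorm {I : X → ℝ} {ι : X →L[ℝ] Y} {u : X} {a : ℝ}
    (ha : a < cNorm I ι u) :
    ∃ v, ⟪ι u, ι v⟫ = 0 ∧ ‖v‖ ≤ 1 ∧ fderiv ℝ I u v < -a := by
  obtain ⟨_, ⟨v, hv, hv1, rfl⟩, hav⟩ := exists_lt_of_lt_csSup
    (s := {r : ℝ | ∃ v : X, ⟪ι u, ι v⟫ = 0 ∧ ‖v‖ ≤ 1 ∧ r = |fderiv ℝ I u v|})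
    ⟨0, 0, by simp, by simp, by simp⟩ ha
  rcases lt_abs.mp hav with h | h
  · exact ⟨-v, by simpa using hv, by simpa using hv1, by simpa using h⟩
  · exact ⟨v, hv, hv1, by linarith⟩

theorem fderiv_neg_of_even {I : X → ℝ} (hI : ∀ u, I (-u) = I u) (u v : X) :
    fderiv ℝ I (-u) v = -fderiv ℝ I u v := by
  have h := (ContinuousLinearEquiv.neg ℝ : X ≃L[ℝ] X).comp_right_fderiv (f := I) (x := u)
  rw [show I ∘ (ContinuousLinearEquiv.neg ℝ : X ≃L[ℝ] X) = I from funext hI] at h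
  rw [h]
  simp

theorem cNorm_neg {I : X → ℝ} (hI : ∀ u, I (-u) = I u) (ι : X →L[ℝ] Y) (u : X) :
    cNorm I ι (-u) = cNorm I ι u := by
  simp [cNorm, fderiv_neg_of_even hI]

theorem cNorm_eq_zero_of_tendsto {I : X → ℝ} (hI : ContDiff ℝ 1 I) {ι : X →L[ℝ] Y} {m : ℝ}
    (hm : 0 < m) {un : ℕ → X} {u : X} (hun : ∀ n, un n ∈ constraintSet ι m)
    (hlim : Tendsto un atTop (𝓝 u))
    (hc : Tendsto (fun n => cNorm I ι (un n)) atTop (𝓝 0)) : cNorm I ι u = 0 := by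
  have hzero : ∀ v, ⟪ι u, ι v⟫ = 0 → fderiv ℝ I u v = 0 := by
    intro v hv
    have hQ : Tendsto (fun n => tangentProj ι m (un n) v) atTop (𝓝 v) := by
      have := (continuous_tangentProj ι m v).tendsto u |>.comp hlim
      rwa [tangentProj_eq_self m hv] at this
    have hD : Tendsto (fun n => fderiv ℝ I (un n) (tangentProj ι m (un n) v)) atTop
        (𝓝 (fderiv ℝ I u v)) :=
      isBoundedBilinearMap_apply.continuous.tendsto (fderiv ℝ I u, v) |>.comp
        ((((hI.continuous_fderiv one_ne_zero).tendsto u).comp hlim).prodMk_nhds hQ)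
    have h := le_of_tendsto_of_tendsto' hD.abs (hc.mul hQ.norm)
      fun n => abs_fderiv_le_cNorm_mul I ι (inner_tangentProj hm (hun n) v)
    rw [zero_mul] at h
    exact abs_nonpos_iff.mp h
  refine le_antisymm ?_ (cNorm_nonneg I ι u)
  by_contra! hlt
  obtain ⟨v, hv, -, hneg⟩ := exists_fderiv_lt_of_lt_cNorm hlt
  rw [hzero v hv] at hneg
  simp at hneg

/-- Moving along a direction of descent and retracting onto the constraint decreases the
functional at a definite rate, uniformly near the base point. -/
theorem exists_descent_step {I : X → ℝ} (hI : ContDiff ℝ 1 I) {ι : X →L[ℝ] Y} {m : ℝ}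
    (hm : 0 < m) {u : X} (hu : u ∈ constraintSet ι m) {V : X → X} (hV : Continuous V) {σ : ℝ}
    (hV2 : ‖tangentProj ι m u (V u)‖ < 2)
    (hVσ : fderiv ℝ I u (tangentProj ι m u (V u)) < -σ) :
    ∃ r > 0, ∀ᶠ w in 𝓝 u, w ∈ constraintSet ι m → ∀ s ∈ Set.Icc 0 r,
      w + s • V w ≠ 0 ∧ I (radialRetract ι m (w + s • V w)) ≤ I w - σ * s ∧
      ‖radialRetract ι m (w + s • V w) - w‖ ≤ 2 * s := by
  have hP := hasStrictFDerivAt_radialRetract hm hu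
  have hI' : HasStrictFDerivAt I (fderiv ℝ I u) (radialRetract ι m u) := by
    rw [radialRetract_eq_self hm hu]
    exact hI.contDiffAt.hasStrictFDerivAt one_ne_zero
  have h1 := hP.eventually_norm_sub_le hV.continuousAt (sub_pos.mpr hV2)
  have h2 := (hI'.comp u hP).eventually_norm_sub_le hV.continuousAt
    (κ := -σ - fderiv ℝ I u (tangentProj ι m u (V u))) (by linarith)
  have h3 : ∀ᶠ p : X × ℝ in 𝓝 u ×ˢ 𝓝 0, p.1 + p.2 • V p.1 ≠ 0 := by
    rw [← nhds_prod_eq]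
    have hcont : ContinuousAt (fun p : X × ℝ => p.1 + p.2 • V p.1) (u, 0) := by fun_prop
    refine hcont.eventually_ne ?_
    simpa using ne_zero_of_mem_constraintSet hm hu
  obtain ⟨pa, hpa, pb, hpb, hp⟩ := eventually_prod_iff.mp (h1.and (h2.and h3))
  obtain ⟨r, hr, hball⟩ := Metric.eventually_nhds_iff.mp hpb
  refine ⟨r / 2, by positivity, hpa.mono fun w hw hwM s hs => ?_⟩
  have hs0 : 0 ≤ s := hs.1
  obtain ⟨ha, hb, hc⟩ := hp hw (hball (y := s) (by
    rw [Real.dist_eq, sub_zero, abs_of_nonneg hs0]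
    linarith [hs.2]))
  refine ⟨hc, ?_, ?_⟩
  · simp only [radialRetract_eq_self hm hwM, Real.norm_eq_abs,
      abs_of_nonneg hs0, ContinuousLinearMap.comp_apply, smul_eq_mul] at hb
    linarith [(abs_le.mp hb).2]
  · simp only [radialRetract_eq_self hm hwM, Real.norm_eq_abs, abs_of_nonneg hs0] at ha
    calc _ = ‖(radialRetract ι m (w + s • V w) - w - s • tangentProj ι m u (V u))
          + s • tangentProj ι m u (V u)‖ := by rw [sub_add_cancel]
      _ ≤ _ := norm_add_le _ _
      _ ≤ (2 - ‖tangentProj ι m u (V u)‖) * s + s * ‖tangentProj ι m u (V u)‖ := by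
        rw [norm_smul, Real.norm_of_nonneg hs0]
        gcongr
      _ = 2 * s := by ring

/-- An odd pseudo-gradient field together with admissible step sizes that are positive on a
given closed set on which the constrained derivative is bounded away from zero. -/
theorem exists_descent_field {I : X → ℝ} (hIeven : ∀ u, I (-u) = I u) (hI : ContDiff ℝ 1 I)
    {ι : X →L[ℝ] Y} {m : ℝ} (hm : 0 < m) {R : Set X} (hR : IsClosed R)
    (hRsymm : ∀ x ∈ R, -x ∈ R) (hRM : R ⊆ constraintSet ι m) {σ : ℝ}
    (hRσ : ∀ x ∈ R, σ < cNorm I ι x) :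
    ∃ (V : X → X) (t : X → ℝ), Continuous V ∧ Continuous t ∧ (∀ x, V (-x) = -V x) ∧
      (∀ x, t (-x) = t x) ∧ (∀ x, 0 ≤ t x) ∧ (∀ x ∈ R, 0 < t x) ∧
      ∀ w ∈ constraintSet ι m, ∀ s ∈ Set.Icc 0 (t w),
        w + s • V w ≠ 0 ∧ I (radialRetract ι m (w + s • V w)) ≤ I w - σ * s ∧
        ‖radialRetract ι m (w + s • V w) - w‖ ≤ 2 * s := by
  have hRsymm' : ∀ x, -x ∈ R → x ∈ R := fun x hx => by simpa using hRsymm _ hx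
  obtain ⟨V, hV, hVodd, hVR⟩ := exists_odd_selection
    (T := fun w => {v : X | w ∈ R → ‖tangentProj ι m w v‖ < 2 ∧
      fderiv ℝ I w (tangentProj ι m w v) < -σ}) (by
      intro w x hx y hy a b ha hb hab hw
      obtain ⟨hx1, hx2⟩ := hx hw
      obtain ⟨hy1, hy2⟩ := hy hw
      constructor
      · have := (convex_ball (0 : X) 2) (x := tangentProj ι m w x) (by simpa using hx1)
          (y := tangentProj ι m w y) (by simpa using hy1) ha hb hab
        simpa using this
      · have := (convex_Iio (-σ)) (x := fderiv ℝ I w (tangentProj ι m w x)) hx2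
          (y := fderiv ℝ I w (tangentProj ι m w y)) hy2 ha hb hab
        simpa using this) (by
      intro x v hv hx
      simpa [tangentProj_neg, fderiv_neg_of_even hIeven] using hv (hRsymm' x hx)) (by
      intro w
      by_cases hw : w ∈ R
      · obtain ⟨v, hv, hv1, hvσ⟩ := exists_fderiv_lt_of_lt_cNorm (hRσ w hw)
        have hQ := continuous_tangentProj ι m v
        refine ⟨v, ?_⟩
        have e1 : ∀ᶠ y in 𝓝 w, ‖tangentProj ι m y v‖ < 2 :=
          hQ.norm.continuousAt.eventually_lt continuousAt_const (by
            rw [tangentProj_eq_self m hv]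
            linarith)
        have e2 : ∀ᶠ y in 𝓝 w, fderiv ℝ I y (tangentProj ι m y v) < -σ :=
          ((hI.continuous_fderiv one_ne_zero).clm_apply hQ).continuousAt.eventually_lt
            continuousAt_const (by rwa [tangentProj_eq_self m hv])
        filter_upwards [e1, e2] with y h1 h2 _ using ⟨h1, h2⟩
      · refine ⟨0, ?_⟩
        filter_upwards [hR.isOpen_compl.mem_nhds hw] with y hy h using absurd h hy)
  obtain ⟨t, ht, hteven, htM⟩ := exists_even_selection
    (T := fun w => {r : ℝ | 0 ≤ r ∧ (w ∈ R → 0 < r) ∧ (w ∈ constraintSet ι m →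
      ∀ s ∈ Set.Icc 0 r, w + s • V w ≠ 0 ∧ I (radialRetract ι m (w + s • V w)) ≤ I w - σ * s ∧
        ‖radialRetract ι m (w + s • V w) - w‖ ≤ 2 * s)}) (by
      intro w
      refine Set.OrdConnected.convex (Set.ordConnected_iff.mpr ?_)
      rintro x ⟨hx0, hxR, -⟩ y ⟨-, -, hyM⟩ - z ⟨hxz, hzy⟩
      exact ⟨hx0.trans hxz, fun h => (hxR h).trans_le hxz,
        fun h s hs => hyM h s ⟨hs.1, hs.2.trans hzy⟩⟩) (by
      rintro w r ⟨hr0, hrR, hrM⟩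
      refine ⟨hr0, fun h => hrR (hRsymm' w h), fun h s hs => ?_⟩
      have hw : w ∈ constraintSet ι m := by simpa using neg_mem_constraintSet h
      obtain ⟨h1, h2, h3⟩ := hrM hw s hs
      have e : -w + s • V (-w) = -(w + s • V w) := by
        rw [hVodd]
        module
      rw [e, radialRetract_neg, hIeven, hIeven]
      refine ⟨neg_ne_zero.mpr h1, h2, ?_⟩
      rwa [← neg_sub', norm_neg]) (by
      intro w
      by_cases hw : w ∈ R
      · obtain ⟨r, hr, hev⟩ := exists_descent_step hI hm (hRM hw) hV (hVR w hw).1 (hVR w hw).2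
        exact ⟨r, hev.mono fun y hy => ⟨hr.le, fun _ => hr, hy⟩⟩
      · refine ⟨0, ?_⟩
        filter_upwards [hR.isOpen_compl.mem_nhds hw] with y hy
        refine ⟨le_rfl, fun h => absurd h hy, fun hyM s hs => ?_⟩
        obtain rfl : s = 0 := le_antisymm hs.2 hs.1
        simpa [radialRetract_eq_self hm hyM] using ne_zero_of_mem_constraintSet hm hyM)
  exact ⟨V, t, hV, ht, hVodd, hteven, fun x => (htM x).1, fun x hx => (htM x).2.1 hx,
    fun w hw => (htM w).2.2 hw⟩

end ConstrainedDerivative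

/-! ### Deformation by iterated descent steps -/

section Deformation

variable {X : Type*} [NormedAddCommGroup X]

/-- Iterated descent steps, up to the real time `τ w`. -/
def stagedFlow (Φ : ℝ → X → X) (τ : X → ℝ) (w : X) : ℕ → X
  | 0 => w
  | j + 1 => Φ (max 0 (min 1 (τ w - j))) (stagedFlow Φ τ w j)

/-- Iterating a descent step leads below a level `a`, provided that the steps do not degenerate
on the region that the orbit can reach before. -/
theorem exists_iterate_lt [CompleteSpace X] {M : Set X} (hM : IsClosed M) {I : X → ℝ}
    (hI : Continuous I) {f : X → X} {t : X → ℝ} {σ a : ℝ} (hσ : 0 < σ) (hfM : Set.MapsTo f M M)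
    (hdesc : ∀ w ∈ M, I (f w) ≤ I w - σ * t w) (hlen : ∀ w ∈ M, ‖f w - w‖ ≤ 2 * t w)
    (ht : Continuous t) (ht0 : ∀ w, 0 ≤ t w) {w : X} (hw : w ∈ M)
    (hreg : ∀ x ∈ M, a ≤ I x → I x ≤ I w → σ * ‖x - w‖ ≤ 2 * (I w - a) → 0 < t x) :
    ∃ N : ℕ, I (f^[N] w) < a := by
  by_contra! hcon
  have hmem : ∀ j, f^[j] w ∈ M := fun j => hfM.iterate j hw
  have hstep : ∀ j, σ * t (f^[j] w) ≤ I (f^[j] w) - I (f^[j + 1] w) := fun j => by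
    rw [Function.iterate_succ_apply']
    linarith [hdesc _ (hmem j)]
  have hdist : ∀ j, dist (f^[j] w) (f^[j + 1] w) ≤ 2 * t (f^[j] w) := fun j => by
    rw [Function.iterate_succ_apply', dist_comm, dist_eq_norm]
    exact hlen _ (hmem j)
  have hsum : ∀ j, σ * ∑ i ∈ Finset.range j, t (f^[i] w) ≤ I w - I (f^[j] w) := fun j => by
    rw [Finset.mul_sum]
    calc _ ≤ ∑ i ∈ Finset.range j, (I (f^[i] w) - I (f^[i + 1] w)) :=
          Finset.sum_le_sum fun i _ => hstep i
      _ = _ := by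
        rw [Finset.sum_range_sub' (fun i => I (f^[i] w)), Function.iterate_zero_apply]
  have hsummable : Summable fun j => t (f^[j] w) :=
    summable_of_sum_range_le (c := (I w - a) / σ) (fun j => ht0 _) fun j => by
      rw [le_div_iff₀ hσ, mul_comm]
      linarith [hsum j, hcon j]
  obtain ⟨x, hx⟩ := cauchySeq_tendsto_of_complete
    (cauchySeq_of_dist_le_of_summable _ hdist (hsummable.mul_left 2))
  have hIx : Tendsto (fun j => I (f^[j] w)) atTop (𝓝 (I x)) := (hI.tendsto x).comp hx
  have htx : t x = 0 :=
    tendsto_nhds_unique ((ht.tendsto x).comp hx) hsummable.tendsto_atTop_zero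
  refine (hreg x (hM.mem_of_tendsto hx (.of_forall hmem)) (ge_of_tendsto' hIx hcon)
    (le_of_tendsto' hIx fun j => ?_) ?_).ne' htx
  · have h0 : 0 ≤ ∑ i ∈ Finset.range j, t (f^[i] w) := Finset.sum_nonneg fun i _ => ht0 _
    nlinarith [hsum j]
  · refine le_of_tendsto' ((hx.sub_const w).norm.const_mul σ) fun j => ?_
    have h1 : ‖f^[j] w - w‖ ≤ 2 * ∑ i ∈ Finset.range j, t (f^[i] w) := by
      rw [← dist_eq_norm, dist_comm, Finset.mul_sum]
      exact dist_le_range_sum_of_dist_le (f := fun i => f^[i] w) j fun {i} _ => hdist i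
    nlinarith [hsum j, hcon j]

/-- An odd homotopy of descent steps can be iterated into an odd deformation that pushes a closed
symmetric set below the level `a`. -/
theorem exists_odd_deformation [CompleteSpace X] {M : Set X} (hM : IsClosed M) {I : X → ℝ}
    (hI : Continuous I) (hIeven : ∀ u, I (-u) = I u) {Φ : ℝ → X → X} {t : X → ℝ} {σ a : ℝ}
    (hσ : 0 < σ) (hΦ : ContinuousOn (fun p : ℝ × X => Φ p.1 p.2) (Set.Icc 0 1 ×ˢ M))
    (hΦM : ∀ s ∈ Set.Icc (0 : ℝ) 1, ∀ w ∈ M, Φ s w ∈ M) (hΦodd : ∀ s w, Φ s (-w) = -Φ s w)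
    (hΦ0 : ∀ w ∈ M, Φ 0 w = w)
    (hdesc : ∀ s ∈ Set.Icc (0 : ℝ) 1, ∀ w ∈ M, I (Φ s w) ≤ I w - σ * (s * t w))
    (hlen : ∀ w ∈ M, ‖Φ 1 w - w‖ ≤ 2 * t w) (ht : Continuous t) (ht0 : ∀ w, 0 ≤ t w)
    {B : Set X} (hB : IsClosed B) (hBsymm : ∀ x ∈ B, -x ∈ B) (hBM : B ⊆ M)
    (hreg : ∀ w ∈ B, ∀ x ∈ M, a ≤ I x → I x ≤ I w → σ * ‖x - w‖ ≤ 2 * (I w - a) → 0 < t x) :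
    ∃ η : X → X, ContinuousOn η B ∧ (∀ x ∈ B, η (-x) = -η x) ∧
      ∀ x ∈ B, η x ∈ M ∧ I (η x) ≤ a := by
  have h01 : (1 : ℝ) ∈ Set.Icc (0 : ℝ) 1 := by simp
  have hclamp : ∀ r : ℝ, max 0 (min 1 r) ∈ Set.Icc (0 : ℝ) 1 := fun r => by simp
  have hfM : Set.MapsTo (Φ 1) M M := hΦM 1 h01
  have hfcont : ContinuousOn (Φ 1) M :=
    hΦ.comp (f := fun w => ((1 : ℝ), w)) (by fun_prop) fun w hw => ⟨h01, hw⟩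
  have hle : ∀ s ∈ Set.Icc (0 : ℝ) 1, ∀ w ∈ M, I (Φ s w) ≤ I w := fun s hs w hw =>
    (hdesc s hs w hw).trans (sub_le_self _ (mul_nonneg hσ.le (mul_nonneg hs.1 (ht0 w))))
  have hanti : ∀ w ∈ M, Antitone fun j => I ((Φ 1)^[j] w) := fun w hw =>
    antitone_nat_of_succ_le fun j => by
      rw [Function.iterate_succ_apply']
      exact hle 1 h01 _ (hfM.iterate j hw)
  have hBsymm' : ∀ x, -x ∈ B → x ∈ B := fun x hx => by simpa using hBsymm _ hx
  have hiter : ∀ j w, (Φ 1)^[j] (-w) = -(Φ 1)^[j] w := fun j w =>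
    ((show Function.Semiconj Neg.neg (Φ 1) (Φ 1) from
      fun w => (hΦodd 1 w).symm).iterate_right j w).symm
  obtain ⟨τ, hτ, hτeven, hτB⟩ := exists_even_selection
    (T := fun w => {r : ℝ | 0 ≤ r ∧ (w ∈ B → I ((Φ 1)^[⌊r⌋₊] w) ≤ a)}) (by
      intro w
      refine Set.OrdConnected.convex (Set.ordConnected_iff.mpr ?_)
      rintro x ⟨hx0, hxB⟩ y - - z ⟨hxz, -⟩
      exact ⟨hx0.trans hxz,
        fun h => (hanti w (hBM h) (Nat.floor_mono hxz)).trans (hxB h)⟩) (by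
      rintro w r ⟨hr0, hrB⟩
      exact ⟨hr0, fun h => by simpa [hiter, hIeven] using hrB (hBsymm' w h)⟩) (by
      intro w
      by_cases hw : w ∈ B
      · obtain ⟨N, hN⟩ := exists_iterate_lt (f := Φ 1) (t := t) hM hI hσ hfM
          (fun w hw => by simpa using hdesc 1 h01 w hw) hlen ht ht0 (hBM hw) (hreg w hw)
        refine ⟨N, ?_⟩
        have hcont : ContinuousWithinAt (fun y => I ((Φ 1)^[N] y)) M w :=
          hI.continuousAt.comp_continuousWithinAt (hfcont.iterate hfM N w (hBM hw))
        filter_upwards [eventually_nhdsWithin_iff.mp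
          (hcont.eventually (gt_mem_nhds hN))] with y hy
        refine ⟨by positivity, fun hyB => ?_⟩
        rw [Nat.floor_natCast]
        exact (hy (hBM hyB)).le
      · refine ⟨0, ?_⟩
        filter_upwards [hB.isOpen_compl.mem_nhds hw] with y hy
        exact ⟨le_rfl, fun h => absurd h hy⟩)
  set F := stagedFlow Φ τ with hF
  have hFM : ∀ j, ∀ w ∈ M, F w j ∈ M := by
    intro j w hw
    induction j with
    | zero => exact hw
    | succ j ih => exact hΦM _ (hclamp _) _ ih
  have hFcont : ∀ j, ContinuousOn (fun w => F w j) M := by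
    intro j
    induction j with
    | zero => exact continuousOn_id
    | succ j ih =>
      exact hΦ.comp (f := fun w => (max 0 (min 1 (τ w - j)), F w j))
        (ContinuousOn.prodMk (by fun_prop) ih) fun w hw => ⟨hclamp _, hFM j w hw⟩
  have hFodd : ∀ j w, F (-w) j = -F w j := by
    intro j w
    induction j with
    | zero => rfl
    | succ j ih =>
      change Φ (max 0 (min 1 (τ (-w) - j))) (F (-w) j) = -Φ (max 0 (min 1 (τ w - j))) (F w j)
      rw [ih, hτeven, hΦodd]
  have hFanti : ∀ w ∈ M, Antitone fun j => I (F w j) := fun w hw =>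
    antitone_nat_of_succ_le fun j => hle _ (hclamp _) _ (hFM j w hw)
  have hFiter : ∀ w, ∀ j : ℕ, (j : ℝ) ≤ τ w → F w j = (Φ 1)^[j] w := by
    intro w j
    induction j with
    | zero => intro _; rfl
    | succ j ih =>
      intro hj
      push_cast at hj
      rw [Function.iterate_succ_apply', ← ih (by linarith)]
      change Φ (max 0 (min 1 (τ w - j))) (F w j) = _
      rw [min_eq_left (by linarith), max_eq_right zero_le_one]
  have hFstable : ∀ w ∈ M, ∀ j : ℕ, ⌈τ w⌉₊ ≤ j → F w j = F w ⌈τ w⌉₊ := by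
    intro w hw j hj
    induction j, hj using Nat.le_induction with
    | base => rfl
    | succ j hj ih =>
      rw [← ih]
      change Φ (max 0 (min 1 (τ w - j))) (F w j) = _
      have : τ w ≤ j := Nat.ceil_le.mp hj
      rw [max_eq_left (min_le_of_right_le (by linarith)), hΦ0 _ (hFM j w hw)]
  refine ⟨fun w => F w ⌈τ w⌉₊, ?_, ?_, ?_⟩
  · intro w hw
    have hev : ∀ᶠ y in 𝓝[B] w, F y (⌈τ w⌉₊ + 1) = F y ⌈τ y⌉₊ := by
      have hlt : τ w < ((⌈τ w⌉₊ + 1 : ℕ) : ℝ) := by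
        push_cast
        linarith [Nat.le_ceil (τ w)]
      filter_upwards [mem_nhdsWithin_of_mem_nhds (hτ.continuousAt.eventually_lt
        continuousAt_const hlt), self_mem_nhdsWithin] with y hy hyB
      exact hFstable y (hBM hyB) _ (Nat.ceil_le.mpr hy.le)
    refine ContinuousWithinAt.congr_of_eventuallyEq (((hFcont (⌈τ w⌉₊ + 1)).mono hBM) w hw)
      (hev.mono fun y hy => hy.symm) (hFstable w (hBM hw) _ (Nat.le_succ _)).symm
  · intro w _
    simp only [hτeven, hFodd]
  · intro w hw
    refine ⟨hFM _ _ (hBM hw), ?_⟩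
    calc I (F w ⌈τ w⌉₊) ≤ I (F w ⌊τ w⌋₊) := hFanti w (hBM hw) (Nat.floor_le_ceil _)
      _ = I ((Φ 1)^[⌊τ w⌋₊] w) := by rw [hFiter w _ (Nat.floor_le (hτB w).1)]
      _ ≤ a := (hτB w).2 hw

end Deformation

/-! ### Critical sets -/

section CriticalSet

variable {X : Type*} [NormedAddCommGroup X] [NormedSpace ℝ X]
variable {Y : Type*} [NormedAddCommGroup Y] [InnerProductSpace ℝ Y]

/-- The critical points of `I` on the constraint at level `c`. -/
def criticalSet (I : X → ℝ) (ι : X →L[ℝ] Y) (m c : ℝ) : Set X :=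
  {u | u ∈ constraintSet ι m ∧ cNorm I ι u = 0 ∧ I u = c}

theorem neg_mem_criticalSet {I : X → ℝ} (hIeven : ∀ u, I (-u) = I u) {ι : X →L[ℝ] Y} {m c : ℝ}
    {u : X} (hu : u ∈ criticalSet I ι m c) : -u ∈ criticalSet I ι m c :=
  ⟨neg_mem_constraintSet hu.1, by rw [cNorm_neg hIeven, hu.2.1], by rw [hIeven, hu.2.2]⟩

/-- Limits of Palais–Smale sequences are critical points. -/
theorem exists_subseq_tendsto_criticalSet {I : X → ℝ} (hI : ContDiff ℝ 1 I) {ι : X →L[ℝ] Y}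
    {m c : ℝ} (hm : 0 < m) (hPS : PSCond I ι m c) {un : ℕ → X}
    (hun : ∀ n, un n ∈ constraintSet ι m) (hIn : Tendsto (fun n => I (un n)) atTop (𝓝 c))
    (hcn : Tendsto (fun n => cNorm I ι (un n)) atTop (𝓝 0)) :
    ∃ u ∈ criticalSet I ι m c, ∃ φ : ℕ → ℕ, StrictMono φ ∧ Tendsto (un ∘ φ) atTop (𝓝 u) := by
  obtain ⟨u, φ, hφ, hlim⟩ := hPS un hun hIn hcn
  refine ⟨u, ⟨(isClosed_constraintSet ι m).mem_of_tendsto hlim (.of_forall fun n => hun _), ?_, ?_⟩,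
    φ, hφ, hlim⟩
  · exact cNorm_eq_zero_of_tendsto hI hm (fun n => hun (φ n)) hlim
      (hcn.comp hφ.tendsto_atTop)
  · exact tendsto_nhds_unique ((hI.continuous.tendsto u).comp hlim)
      (hIn.comp hφ.tendsto_atTop)

theorem isCompact_criticalSet {I : X → ℝ} (hI : ContDiff ℝ 1 I) {ι : X →L[ℝ] Y} {m c : ℝ}
    (hm : 0 < m) (hPS : PSCond I ι m c) : IsCompact (criticalSet I ι m c) := by
  refine IsSeqCompact.isCompact fun un hun => ?_
  exact exists_subseq_tendsto_criticalSet hI hm hPS (fun n => (hun n).1)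
    (tendsto_const_nhds.congr fun n => (hun n).2.2.symm)
    (tendsto_const_nhds.congr fun n => (hun n).2.1.symm)

/-- Away from the critical set, the constrained derivative is bounded below near the level. -/
theorem exists_lt_cNorm_of_le_dist {I : X → ℝ} (hI : ContDiff ℝ 1 I) {ι : X →L[ℝ] Y} {m c : ℝ}
    (hm : 0 < m) (hPS : PSCond I ι m c) {δ : ℝ} (hδ : 0 < δ) :
    ∃ σ > 0, ∀ w ∈ constraintSet ι m, |I w - c| ≤ σ →
      (∀ z ∈ criticalSet I ι m c, δ ≤ dist w z) → σ < cNorm I ι w := by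
  by_contra! hcon
  choose un hun hIn hdist hcn using fun n : ℕ => hcon (1 / (n + 1)) (by positivity)
  have hzero := tendsto_one_div_add_atTop_nhds_zero_nat (𝕜 := ℝ)
  obtain ⟨u, hu, φ, -, hlim⟩ := exists_subseq_tendsto_criticalSet hI hm hPS hun
    (by
      rw [tendsto_iff_dist_tendsto_zero]
      exact squeeze_zero (fun _ => dist_nonneg) hIn hzero)
    (squeeze_zero (fun _ => cNorm_nonneg I ι _) hcn hzero)
  have h := ge_of_tendsto' (tendsto_iff_dist_tendsto_zero.mp hlim) fun n => hdist (φ n) u hu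
  linarith

/-- The equivariant deformation lemma. -/
theorem exists_odd_deformation_below [CompleteSpace X] {I : X → ℝ}
    (hIeven : ∀ u, I (-u) = I u) (hI : ContDiff ℝ 1 I) {ι : X →L[ℝ] Y}
    (hι : Function.Injective ι) {m c : ℝ} (hm : 0 < m) (hPS : PSCond I ι m c) {δ ε₀ : ℝ}
    (hδ : 0 < δ) (hε₀ : 0 < ε₀) :
    ∃ ε > 0, ε ≤ ε₀ ∧ ∀ B ⊆ constraintSet ι m, IsClosed B → (∀ x ∈ B, -x ∈ B) →
      (∀ w ∈ B, I w ≤ c + ε ∧ ∀ z ∈ criticalSet I ι m c, δ ≤ dist w z) →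
      ∃ η : X → X, ContinuousOn η B ∧ (∀ x ∈ B, η (-x) = -η x) ∧
        ∀ x ∈ B, η x ∈ constraintSet ι m ∧ I (η x) ≤ c - ε := by
  obtain ⟨σ, hσ, hσc⟩ := exists_lt_cNorm_of_le_dist hI hm hPS (half_pos hδ)
  set ε := min ε₀ (min σ (σ * δ / 8)) with hεdef
  have hεσ : ε ≤ σ := (min_le_right _ _).trans (min_le_left _ _)
  have hεδ : ε ≤ σ * δ / 8 := (min_le_right _ _).trans (min_le_right _ _)
  refine ⟨ε, by positivity, min_le_left _ _, fun B hBM hB hBsymm hBI => ?_⟩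
  set R : Set X := {w | w ∈ constraintSet ι m ∧ |I w - c| ≤ ε ∧
    ∀ z ∈ criticalSet I ι m c, δ / 2 ≤ dist w z} with hRdef
  have hR : IsClosed R := by
    refine (isClosed_constraintSet ι m).inter (IsClosed.inter ?_ ?_)
    · exact isClosed_le ((hI.continuous.sub continuous_const).abs) continuous_const
    · have : {w : X | ∀ z ∈ criticalSet I ι m c, δ / 2 ≤ dist w z} =
          ⋂ z ∈ criticalSet I ι m c, {w | δ / 2 ≤ dist w z} := by
        ext
        simp
      change IsClosed {w : X | ∀ z ∈ criticalSet I ι m c, δ / 2 ≤ dist w z}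
      rw [this]
      exact isClosed_biInter fun z _ => isClosed_le continuous_const (by fun_prop)
  have hRsymm : ∀ x ∈ R, -x ∈ R := fun x hx => by
    refine ⟨neg_mem_constraintSet hx.1, by rw [hIeven]; exact hx.2.1, fun z hz => ?_⟩
    have := hx.2.2 (-z) (neg_mem_criticalSet hIeven hz)
    rwa [← dist_neg_neg, neg_neg] at this
  obtain ⟨V, t, hV, ht, hVodd, hteven, ht0, htR, hstep⟩ := exists_descent_field hIeven hI hm hR
    hRsymm (fun x hx => hx.1) (σ := σ) fun x hx => hσc x hx.1 (hx.2.1.trans hεσ) hx.2.2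
  have hs : ∀ s ∈ Set.Icc (0 : ℝ) 1, ∀ w, s * t w ∈ Set.Icc 0 (t w) := fun s hs w =>
    ⟨mul_nonneg hs.1 (ht0 w), mul_le_of_le_one_left (ht0 w) hs.2⟩
  refine exists_odd_deformation (Φ := fun s w => radialRetract ι m (w + (s * t w) • V w))
    (t := t) (isClosed_constraintSet ι m) hI.continuous hIeven hσ ?_ ?_ ?_ ?_ ?_ ?_ ht ht0 hB
    hBsymm hBM ?_
  · rintro ⟨s, w⟩ ⟨hs1, hw⟩
    refine ContinuousAt.continuousWithinAt ?_
    exact ContinuousAt.comp (f := fun p : ℝ × X => p.2 + (p.1 * t p.2) • V p.2) (x := (s, w))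
      (continuousAt_radialRetract hι m (hstep w hw _ (hs s hs1 w)).1) (by fun_prop)
  · exact fun s hs1 w hw => radialRetract_mem hι hm (hstep w hw _ (hs s hs1 w)).1
  · intro s w
    rw [← radialRetract_neg, hteven, hVodd]
    congr 1
    module
  · intro w hw
    simp [radialRetract_eq_self hm hw]
  · exact fun s hs1 w hw => (hstep w hw _ (hs s hs1 w)).2.1
  · intro w hw
    simpa using (hstep w hw _ (hs 1 (by simp) w)).2.2
  · intro w hw x hx hax hxw hdist
    refine htR x ⟨hx, ?_, fun z hz => ?_⟩
    · rw [abs_le]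
      constructor <;> linarith [(hBI w hw).1]
    · have h1 : σ * ‖x - w‖ ≤ σ * (δ / 2) := by linarith [(hBI w hw).1]
      have h2 : dist x w ≤ δ / 2 := by
        rw [dist_eq_norm]
        exact le_of_mul_le_mul_left h1 hσ
      have h3 := dist_triangle w x z
      rw [dist_comm w x] at h3
      linarith [(hBI w hw).2 z hz]

end CriticalSet

/-! ### The minimax principle -/

section Minimax

variable {X : Type*} [NormedAddCommGroup X] [NormedSpace ℝ X]
variable {Y : Type*} [NormedAddCommGroup Y] [InnerProductSpace ℝ Y]

theorem bddBelow_sSup_image {α : Type*} {I : α → ℝ} {M : Set α} (hbdd : BddBelow (I '' M))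
    {S : Set (Set α)} (hSM : ∀ A ∈ S, A ⊆ M) :
    BddBelow {r : ℝ | ∃ A ∈ S, r = sSup (I '' A)} := by
  obtain ⟨b, hb⟩ := hbdd
  refine ⟨min b 0, ?_⟩
  rintro _ ⟨A, hA, rfl⟩
  rcases A.eq_empty_or_nonempty with rfl | ⟨x, hx⟩
  · simp
  by_cases hbd : BddAbove (I '' A)
  · exact (min_le_left _ _).trans ((hb ⟨x, hSM A hA hx, rfl⟩).trans (le_csSup hbd ⟨x, hx, rfl⟩))
  · rw [Real.sSup_of_not_bddAbove hbd]
    exact min_le_right _ _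

theorem le_of_sSup_image_neg {α : Type*} {I : α → ℝ} {A : Set α} {r : ℝ}
    (hr : sSup (I '' A) < r) (hr0 : r ≤ 0) {x : α} (hx : x ∈ A) : I x ≤ r := by
  have hbd : BddAbove (I '' A) := by
    by_contra h
    rw [Real.sSup_of_not_bddAbove h] at hr
    linarith
  exact (le_csSup hbd ⟨x, hx, rfl⟩).trans hr.le

/-- If the critical set at a negative level `c` has genus at most `p`, then sets of genus at
least `k + p` whose supremum is close to `c` yield sets of genus at least `k` below `c`. -/
theorem exists_genus_le_below [CompleteSpace X] {I : X → ℝ}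
    (hIeven : ∀ u, I (-u) = I u) (hI : ContDiff ℝ 1 I) {ι : X →L[ℝ] Y}
    (hι : Function.Injective ι) {m c : ℝ} (hm : 0 < m) (hPS : PSCond I ι m c) {ε₀ : ℝ}
    (hε₀ : 0 < ε₀) {p k : ℕ} (hk : 1 ≤ k) (hp : genus (criticalSet I ι m c) ≤ p) :
    ∃ ε > 0, ε ≤ ε₀ ∧ ∀ A ⊆ constraintSet ι m, IsClosed A → (∀ x ∈ A, -x ∈ A) →
      ((k + p : ℕ) : ℕ∞) ≤ genus A → (∀ x ∈ A, I x ≤ c + ε) →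
      ∃ D ⊆ constraintSet ι m, IsClosed D ∧ (∀ x ∈ D, -x ∈ D) ∧ (k : ℕ∞) ≤ genus D ∧
        ∀ x ∈ D, I x ≤ c - ε := by
  have hK := isCompact_criticalSet hI hm hPS
  obtain ⟨j, hj, φ, hφ, hφodd, hφne⟩ := exists_odd_map_of_genus_le hp
  obtain ⟨ψ, hψ, hψodd, hψφ⟩ := exists_odd_extension hK.isClosed
    (fun x hx => neg_mem_criticalSet hIeven hx) hφ hφodd
  obtain ⟨δ, hδ, hthick⟩ := hK.exists_thickening_subset_open (t := {x | ψ x ≠ 0})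
    (isOpen_ne_fun hψ continuous_const) fun x hx => by
      change ψ x ≠ 0
      rw [hψφ x hx]
      exact hφne x hx
  obtain ⟨ε, hε, hεε₀, hdef⟩ := exists_odd_deformation_below hIeven hI hι hm hPS hδ hε₀
  refine ⟨ε, hε, hεε₀, fun A hAM hA hAsymm hAgenus hAI => ?_⟩
  set B := A ∩ (Metric.thickening δ (criticalSet I ι m c))ᶜ with hBdef
  have hB : IsClosed B := hA.inter Metric.isOpen_thickening.isClosed_compl
  have hBdist : ∀ w ∈ B, ∀ z ∈ criticalSet I ι m c, δ ≤ dist w z := by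
    intro w hw z hz
    by_contra! hlt
    exact hw.2 (Metric.mem_thickening_iff.mpr ⟨z, hz, hlt⟩)
  have hBsymm : ∀ x ∈ B, -x ∈ B := by
    refine fun x hx => ⟨hAsymm x hx.1, fun hmem => ?_⟩
    obtain ⟨z, hz, hlt⟩ := Metric.mem_thickening_iff.mp hmem
    have := hBdist x hx (-z) (neg_mem_criticalSet hIeven hz)
    rw [← dist_neg_neg, neg_neg] at this
    linarith
  have hBgenus : (k : ℕ∞) ≤ genus B := by
    by_contra! hlt
    have hle : genus B ≤ (k - 1 : ℕ) := by
      rw [← ENat.lt_natCast_add_one_iff]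
      rwa [← Nat.cast_add_one, Nat.sub_add_cancel hk]
    have h := hAgenus.trans (genus_le_add (A := A) hB hBsymm hle hψ hψodd fun x hx => by
      by_cases hxt : x ∈ Metric.thickening δ (criticalSet I ι m c)
      · exact Or.inr (hthick hxt)
      · exact Or.inl ⟨hx, hxt⟩)
    have h' : k + p ≤ k - 1 + j := by exact_mod_cast h
    omega
  obtain ⟨η, hη, hηodd, hηB⟩ := hdef B (Set.inter_subset_left.trans hAM) hB hBsymm
    fun w hw => ⟨hAI w hw.1, hBdist w hw⟩
  refine ⟨closure (η '' B), ?_, isClosed_closure, ?_, ?_, ?_⟩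
  · refine closure_minimal ?_ (isClosed_constraintSet ι m)
    rintro _ ⟨x, hx, rfl⟩
    exact (hηB x hx).1
  · intro x hx
    refine (show Set.MapsTo Neg.neg (η '' B) (η '' B) from ?_).closure continuous_neg hx
    rintro _ ⟨y, hy, rfl⟩
    exact ⟨-y, hBsymm y hy, hηodd y hy⟩
  · exact hBgenus.trans (genus_le_of_mapsTo hη hηodd
      fun x hx => subset_closure (Set.mem_image_of_mem η hx))
  · refine fun x hx => closure_minimal (t := {x | I x ≤ c - ε}) ?_
      (isClosed_le hI.continuous continuous_const) hx
    rintro _ ⟨y, hy, rfl⟩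
    exact (hηB y hy).2

end Minimax

theorem statement3 (ι : E →L[ℝ] H) (hι : Function.Injective ι)
    (m : ℝ) (hm : 0 < m)
    (M : Set E) (hM : M = {u : E | ⟪ι u, ι u⟫ = m})
    (I : E → ℝ) (hIeven : ∀ u, I (-u) = I u) (hIC1 : ContDiff ℝ 1 I)
    (hbdd : BddBelow (I '' M))
    (hPS : ∀ c : ℝ, c < 0 → PSCond I ι m c)
    (n : ℕ)
    (Γ : ℕ → Set (Set E))
    (hΓ : ∀ k, Γ k = {A : Set E | A ⊆ M ∧ IsClosed A ∧
      (∀ x ∈ A, -x ∈ A) ∧ (k : ℕ∞) ≤ genus A})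
    (hΓne : ∀ k, 1 ≤ k → k ≤ n → (Γ k).Nonempty)
    (c : ℕ → ℝ)
    (hc : ∀ k, c k = sInf {r : ℝ | ∃ A ∈ Γ k, r = sSup (I '' A)}) :
    -- the minimax values are monotone
    (∀ k, 1 ≤ k → k < n → c k ≤ c (k + 1)) ∧
    -- (i) each negative `c k` is a critical value of `I|_M`
    (∀ k, 1 ≤ k → k ≤ n → c k < 0 →
      ∃ u ∈ M, cNorm I ι u = 0 ∧ I u = c k) ∧
    -- (ii) in case of multiplicity the genus of the critical set at that level is large
    (∀ k l : ℕ, 1 ≤ k → 1 ≤ l → k + l - 1 ≤ n →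
      (∀ j, k ≤ j → j ≤ k + l - 1 → c j = c k) → c k < 0 →
      (l : ℕ∞) ≤ genus {u : E | u ∈ M ∧ cNorm I ι u = 0 ∧ I u = c k}) ∧
    -- hence `I|_M` has at least `n` critical points
    ((∀ k, 1 ≤ k → k ≤ n → c k < 0) →
      ∃ us : Fin n → E, Function.Injective us ∧
        ∀ j, us j ∈ M ∧ cNorm I ι (us j) = 0) := by
  have hMc : M = constraintSet ι m := hM
  have hcrit : ∀ r, {u : E | u ∈ M ∧ cNorm I ι u = 0 ∧ I u = r} = criticalSet I ι m r :=
    fun r => by rw [hMc]; rfl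
  have hΓM : ∀ k, ∀ A ∈ Γ k, A ⊆ M := fun k A hA => by
    rw [hΓ] at hA
    exact hA.1
  have hmono : ∀ k, 1 ≤ k → k < n → c k ≤ c (k + 1) := by
    intro k _ hkn
    rw [hc, hc]
    refine csInf_le_csInf (bddBelow_sSup_image hbdd (hΓM k)) ?_ ?_
    · obtain ⟨A, hA⟩ := hΓne (k + 1) (by omega) (by omega)
      exact ⟨_, A, hA, rfl⟩
    · rintro r ⟨A, hA, rfl⟩
      refine ⟨A, ?_, rfl⟩
      rw [hΓ] at hA ⊢
      exact ⟨hA.1, hA.2.1, hA.2.2.1, le_trans (by exact_mod_cast Nat.le_succ k) hA.2.2.2⟩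
  have hmult : ∀ k l : ℕ, 1 ≤ k → 1 ≤ l → k + l - 1 ≤ n →
      (∀ j, k ≤ j → j ≤ k + l - 1 → c j = c k) → c k < 0 →
      (l : ℕ∞) ≤ genus {u : E | u ∈ M ∧ cNorm I ι u = 0 ∧ I u = c k} := by
    intro k l hk hl hkl hcj hneg
    rw [hcrit]
    by_contra! hlt
    have hp : genus (criticalSet I ι m (c k)) ≤ (l - 1 : ℕ) := by
      rw [← ENat.lt_natCast_add_one_iff]
      rwa [← Nat.cast_add_one, Nat.sub_add_cancel hl]
    obtain ⟨ε, hε, hεle, hdef⟩ := exists_genus_le_below hIeven hIC1 hι hm (hPS _ hneg)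
      (neg_pos.mpr hneg) hk hp
    have hkl' : k + (l - 1) = k + l - 1 := by omega
    obtain ⟨A₀, hA₀⟩ := hΓne (k + l - 1) (by omega) hkl
    have hlt' : sInf {r : ℝ | ∃ A ∈ Γ (k + l - 1), r = sSup (I '' A)} < c k + ε := by
      rw [← hc, hcj _ (by omega) le_rfl]
      linarith
    obtain ⟨_, ⟨A, hA, rfl⟩, hAε⟩ := exists_lt_of_csInf_lt
      (s := {r : ℝ | ∃ A ∈ Γ (k + l - 1), r = sSup (I '' A)}) ⟨_, A₀, hA₀, rfl⟩ hlt'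
    rw [hΓ, ← hkl'] at hA
    obtain ⟨hAM, hAcl, hAsymm, hAgenus⟩ := hA
    obtain ⟨D, hDM, hDcl, hDsymm, hDgenus, hDI⟩ := hdef A (hMc ▸ hAM) hAcl hAsymm hAgenus
      fun x hx => le_of_sSup_image_neg hAε (by linarith) hx
    have hA'Γ : D ∈ Γ k := by
      rw [hΓ]
      exact ⟨hMc ▸ hDM, hDcl, hDsymm, hDgenus⟩
    have h1 : c k ≤ sSup (I '' D) := by
      rw [hc k]
      exact csInf_le (bddBelow_sSup_image hbdd (hΓM k)) ⟨D, hA'Γ, rfl⟩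
    have h2 : sSup (I '' D) ≤ c k - ε := by
      refine csSup_le ((nonempty_of_one_le_genus ?_).image I) ?_
      · exact le_trans (by exact_mod_cast hk) hDgenus
      · rintro _ ⟨x, hx, rfl⟩
        exact hDI x hx
    linarith
  have hvalue : ∀ k, 1 ≤ k → k ≤ n → c k < 0 → ∃ u ∈ M, cNorm I ι u = 0 ∧ I u = c k := by
    intro k hk hkn hneg
    obtain ⟨u, huM, hu⟩ := nonempty_of_one_le_genus
      (by exact_mod_cast hmult k 1 hk le_rfl (by omega) (fun j h1 h2 => by
        rw [show j = k by omega]) hneg)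
    exact ⟨u, huM, hu⟩
  refine ⟨hmono, hvalue, hmult, fun hneg => ?_⟩
  by_cases hstrict : ∀ k, 1 ≤ k → k < n → c k < c (k + 1)
  · choose us husM husc husI using fun j : Fin n =>
      hvalue (j + 1) (by omega) (by omega) (hneg (j + 1) (by omega) (by omega))
    have hsm : ∀ d k, 1 ≤ k → k + d + 1 ≤ n → c k < c (k + d + 1) := by
      intro d
      induction d with
      | zero => exact fun k hk hkn => hstrict k hk (by omega)
      | succ d ih =>
        exact fun k hk hkn =>
          (ih k hk (by omega)).trans (hstrict (k + d + 1) (by omega) (by omega))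
    have hlt : ∀ i j : Fin n, i < j → us i ≠ us j := by
      intro i j hij heq
      have h := hsm (j - i - 1) (i + 1) (by omega) (by omega)
      rw [show (i : ℕ) + 1 + (j - i - 1) + 1 = j + 1 by omega, ← husI i, ← husI j, heq] at h
      exact lt_irrefl _ h
    refine ⟨us, fun i j heq => ?_, fun j => ⟨husM j, husc j⟩⟩
    rcases lt_trichotomy i j with h | h | h
    · exact absurd heq (hlt i j h)
    · exact h
    · exact absurd heq.symm (hlt j i h)
  · push Not at hstrict
    obtain ⟨k, hk, hkn, hle⟩ := hstrict
    have heq : c (k + 1) = c k := le_antisymm hle (hmono k hk hkn)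
    have hgenus := hmult k 2 hk (by norm_num) (by omega) (fun j h1 h2 => by
      obtain rfl | rfl : j = k ∨ j = k + 1 := by omega
      · rfl
      · exact heq) (hneg k hk hkn.le)
    have hinf : {u : E | u ∈ M ∧ cNorm I ι u = 0 ∧ I u = c k}.Infinite := by
      intro hfin
      have h0 : (0 : E) ∉ {u : E | u ∈ M ∧ cNorm I ι u = 0 ∧ I u = c k} := fun h =>
        ne_zero_of_mem_constraintSet hm (hMc ▸ h.1) rfl
      have h21 := hgenus.trans (genus_le_one_of_finite hfin h0)
      norm_num at h21
    refine ⟨fun j => hinf.natEmbedding _ j, fun i j hij => ?_, fun j => ?_⟩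
    · exact Fin.ext ((hinf.natEmbedding _).injective (Subtype.ext hij))
    · obtain ⟨hM', hc', -⟩ := (hinf.natEmbedding _ j).2
      exact ⟨hM', hc'⟩
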